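/- Let m \le -1. The map \Phi_m is injective on the set \{ (u,a) \in \mathbb{R}^2 : a \ge 0,\ 4u^2m^2 - 4a^2 > -\pi^2 \}. (This set is the slice \Sigma_m of the maximal adapted complexification \Omega_m of (SL_2(\mathbb{R}), \nu_m) for m \le -1, and the injectivity of \Phi_m = \hat P_m on it implies that the polar map P_m : \Omega_m \to SL_2(\mathbb{C}) is injective.) -/

import Mathlib

open Real

/-- `C x = ∑ xⁿ/(2n)!`, i.e. `cosh √x` for `x ≥ 0` and `cos √(-x)` for `x ≤ 0`. -/
noncomputable def C (x : ℝ) : ℝ := ∑' n : ℕ, x ^ n / (Nat.factorial (2 * n))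

/-- `S x = ∑ xⁿ/(2n+1)!`, i.e. `sinh √x/√x` for `x > 0` and `sin √(-x)/√(-x)` for `x < 0`. -/
noncomputable def S (x : ℝ) : ℝ := ∑' n : ℕ, x ^ n / (Nat.factorial (2 * n + 1))

/-- The reduced polar map `Φₘ = P̂ₘ` of the metric `νₘ` on `SL₂(ℝ)` in the slice
coordinates `(u, a)`, with `x = 4u²m² - 4a²`. -/
noncomputable def Phi (m : ℝ) (p : ℝ × ℝ) : ℝ × ℝ :=
  (Real.exp (-(2 * p.1 * (1 + m))) *
      (C (4 * p.1 ^ 2 * m ^ 2 - 4 * p.2 ^ 2) +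
        2 * p.1 * m * S (4 * p.1 ^ 2 * m ^ 2 - 4 * p.2 ^ 2)),
   Real.exp (2 * p.1 * (1 + m)) *
      (C (4 * p.1 ^ 2 * m ^ 2 - 4 * p.2 ^ 2) -
        2 * p.1 * m * S (4 * p.1 ^ 2 * m ^ 2 - 4 * p.2 ^ 2)))

section

open Set

theorem summable_pow_div_of_factorial_le {b : ℕ → ℕ} (hb : ∀ n, n.factorial ≤ b n) (x : ℝ) :
    Summable fun n ↦ x ^ n / (b n : ℝ) := by
  refine .of_norm_bounded (Real.summable_pow_div_factorial |x|) fun n ↦ ?_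
  have : (0 : ℝ) < n.factorial := mod_cast n.factorial_pos
  have h : (n.factorial : ℝ) ≤ b n := mod_cast hb n
  rw [norm_div, norm_pow, Real.norm_eq_abs, Real.norm_natCast]
  gcongr

theorem norm_deriv_term_le {b : ℕ → ℕ} (hb : ∀ n, n.factorial ≤ b n) {x R : ℝ} (hx : |x| ≤ R)
    (n : ℕ) : ‖n * x ^ (n - 1) / (b n : ℝ)‖ ≤ n * R ^ (n - 1) / n.factorial := by
  have : (0 : ℝ) < n.factorial := mod_cast n.factorial_pos
  have h : (n.factorial : ℝ) ≤ b n := mod_cast hb n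
  have hR : 0 ≤ R := (abs_nonneg x).trans hx
  rw [norm_div, norm_mul, norm_pow, Real.norm_eq_abs x, Real.norm_natCast, Real.norm_natCast]
  gcongr

theorem summable_deriv_exp_term (R : ℝ) :
    Summable fun n : ℕ ↦ n * R ^ (n - 1) / (n.factorial : ℝ) := by
  rw [← summable_nat_add_iff 1]
  refine (Real.summable_pow_div_factorial R).congr fun n ↦ ?_
  have : (n.factorial : ℝ) ≠ 0 := mod_cast n.factorial_ne_zero
  rw [Nat.factorial_succ]
  push_cast
  field_simp

theorem summable_deriv_term {b : ℕ → ℕ} (hb : ∀ n, n.factorial ≤ b n) (x : ℝ) :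
    Summable fun n : ℕ ↦ n * x ^ (n - 1) / (b n : ℝ) :=
  .of_norm_bounded (summable_deriv_exp_term |x|) (norm_deriv_term_le hb le_rfl)

theorem hasDerivAt_tsum_pow_div {b : ℕ → ℕ} (hb : ∀ n, n.factorial ≤ b n) (x : ℝ) :
    HasDerivAt (fun z : ℝ ↦ ∑' n, z ^ n / (b n : ℝ)) (∑' n : ℕ, n * x ^ (n - 1) / (b n : ℝ)) x := by
  have hx : x ∈ Metric.ball (0 : ℝ) (|x| + 1) := by simp
  refine hasDerivAt_tsum_of_isPreconnected (summable_deriv_exp_term (|x| + 1)) Metric.isOpen_ball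
    (convex_ball _ _).isPreconnected (g' := fun n y ↦ n * y ^ (n - 1) / (b n : ℝ))
    (fun n y _ ↦ (hasDerivAt_pow n y).div_const _)
    (fun n y hy ↦ norm_deriv_term_le hb ?_ n) hx (summable_pow_div_of_factorial_le hb x) hx
  simpa using (mem_ball_zero_iff.mp hy).le

theorem factorial_le_factorial_two_mul (n : ℕ) : n.factorial ≤ (2 * n).factorial :=
  Nat.factorial_le (by omega)

theorem factorial_le_factorial_two_mul_add_one (n : ℕ) :
    n.factorial ≤ (2 * n + 1).factorial :=
  Nat.factorial_le (by omega)

theorem hasDerivAt_C (x : ℝ) : HasDerivAt C (S x / 2) x := by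
  have hs := summable_deriv_term factorial_le_factorial_two_mul x
  convert! hasDerivAt_tsum_pow_div factorial_le_factorial_two_mul x using 1
  rw [hs.tsum_eq_zero_add, S, ← tsum_div_const]
  simp only [CharP.cast_eq_zero, zero_mul, zero_div, zero_add, Nat.add_sub_cancel]
  refine tsum_congr fun n ↦ ?_
  have : ((2 * n + 1).factorial : ℝ) ≠ 0 := mod_cast Nat.factorial_ne_zero _
  rw [show 2 * (n + 1) = (2 * n + 1) + 1 by ring, Nat.factorial_succ (2 * n + 1)]
  push_cast
  generalize ((2 * n + 1).factorial : ℝ) = k at *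
  field_simp
  ring

/-- The derivative of `S`. -/
noncomputable def S' (x : ℝ) : ℝ := ∑' n : ℕ, n * x ^ (n - 1) / ((2 * n + 1).factorial : ℝ)

theorem hasDerivAt_S (x : ℝ) : HasDerivAt S (S' x) x :=
  hasDerivAt_tsum_pow_div factorial_le_factorial_two_mul_add_one x

theorem two_mul_mul_S' (x : ℝ) : 2 * x * S' x = C x - S x := by
  rw [C, S, S', ← (summable_pow_div_of_factorial_le factorial_le_factorial_two_mul x).tsum_sub
    (summable_pow_div_of_factorial_le factorial_le_factorial_two_mul_add_one x), ← tsum_mul_left]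
  refine tsum_congr fun n ↦ ?_
  have : ((2 * n).factorial : ℝ) ≠ 0 := mod_cast Nat.factorial_ne_zero _
  rw [Nat.factorial_succ]
  rcases n with _ | n
  · simp
  · push_cast
    field_simp
    ring

theorem C_sq (s : ℝ) : C (s ^ 2) = cosh s := by
  rw [Real.cosh_eq_tsum, C]
  simp only [pow_mul]

theorem mul_S_sq (s : ℝ) : s * S (s ^ 2) = sinh s := by
  rw [Real.sinh_eq_tsum, S, ← tsum_mul_left]
  refine tsum_congr fun n ↦ ?_
  ring

theorem C_neg_sq (s : ℝ) : C (-s ^ 2) = cos s := by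
  rw [Real.cos_eq_tsum, C]
  refine tsum_congr fun n ↦ ?_
  rw [neg_pow, pow_mul]

theorem mul_S_neg_sq (s : ℝ) : s * S (-s ^ 2) = sin s := by
  rw [Real.sin_eq_tsum, S, ← tsum_mul_left]
  refine tsum_congr fun n ↦ ?_
  rw [neg_pow]
  ring

theorem C_sq_sub_mul_S_sq (x : ℝ) : C x ^ 2 - x * S x ^ 2 = 1 := by
  rcases le_total 0 x with h | h
  · have hx := Real.sq_sqrt h
    have h1 := C_sq √x
    have h2 := mul_S_sq √x
    have h3 := Real.cosh_sq_sub_sinh_sq √x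
    rw [← h1, ← h2, mul_pow, hx] at h3
    exact h3
  · have hx := Real.sq_sqrt (neg_nonneg.mpr h)
    have h1 := C_neg_sq √(-x)
    have h2 := mul_S_neg_sq √(-x)
    have h3 := Real.sin_sq_add_cos_sq √(-x)
    rw [← h1, ← h2, mul_pow, hx, neg_neg] at h3
    linarith

theorem exists_eq_neg_sq {x : ℝ} (hx : -π ^ 2 < x) (h : x < 0) :
    ∃ s, 0 < s ∧ s < π ∧ x = -s ^ 2 := by
  refine ⟨√(-x), Real.sqrt_pos.mpr (by linarith), ?_, ?_⟩
  · rw [Real.sqrt_lt' Real.pi_pos]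
    linarith
  · rw [Real.sq_sqrt (by linarith), neg_neg]

theorem S_pos {x : ℝ} (hx : -π ^ 2 < x) : 0 < S x := by
  rcases lt_or_ge x 0 with h | h
  · obtain ⟨s, hs, hsπ, rfl⟩ := exists_eq_neg_sq hx h
    have := Real.sin_pos_of_pos_of_lt_pi hs hsπ
    rw [← mul_S_neg_sq] at this
    exact pos_of_mul_pos_right this hs.le
  · refine (summable_pow_div_of_factorial_le factorial_le_factorial_two_mul_add_one x).tsum_pos
      (fun n ↦ by positivity) 0 (by simp)

theorem S'_nonneg {x : ℝ} (hx : -π ^ 2 < x) : 0 ≤ S' x := by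
  rcases lt_or_ge x 0 with h | h
  · have hSC : C x ≤ S x := by
      obtain ⟨s, hs, hsπ, rfl⟩ := exists_eq_neg_sq hx h
      have hS := S_pos hx
      rcases lt_or_ge s (π / 2) with h2 | h2
      · have hc := Real.cos_pos_of_mem_Ioo ⟨by linarith, h2⟩
        have ht := Real.lt_tan hs h2
        rw [Real.tan_eq_sin_div_cos, lt_div_iff₀ hc, ← mul_S_neg_sq, ← C_neg_sq] at ht
        exact (lt_of_mul_lt_mul_left ht hs.le).le
      · have := Real.cos_nonpos_of_pi_div_two_le_of_le h2 (by linarith)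
        rw [← C_neg_sq] at this
        linarith
    have := two_mul_mul_S' x
    by_contra! hneg
    nlinarith
  · exact tsum_nonneg fun n ↦ by positivity

theorem continuous_C : Continuous C :=
  continuous_iff_continuousAt.mpr fun x ↦ (hasDerivAt_C x).continuousAt

theorem strictMonoOn_C : StrictMonoOn C (Ici (-π ^ 2)) := by
  refine strictMonoOn_of_deriv_pos (convex_Ici _) continuous_C.continuousOn fun x hx ↦ ?_
  rw [interior_Ici] at hx
  rw [(hasDerivAt_C x).deriv]
  exact half_pos (S_pos hx)

theorem neg_one_lt_C {x : ℝ} (hx : -π ^ 2 < x) : -1 < C x := by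
  have := strictMonoOn_C self_mem_Ici hx.le hx
  rwa [C_neg_sq, Real.cos_pi] at this

theorem exists_C_eq {y : ℝ} (hy : -1 < y) : ∃ x, -π ^ 2 < x ∧ C x = y := by
  rcases le_total y 1 with h | h
  · refine ⟨-arccos y ^ 2, ?_, by rw [C_neg_sq, Real.cos_arccos hy.le h]⟩
    have h1 : arccos y < π := by
      refine (Real.arccos_le_pi y).lt_of_ne fun h ↦ ?_
      rw [Real.arccos_eq_pi] at h
      linarith
    have h0 := Real.arccos_nonneg y
    gcongr
  · refine ⟨arcosh y ^ 2, ?_, by rw [C_sq, Real.cosh_arcosh h]⟩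
    have := Real.pi_pos
    nlinarith [sq_nonneg (arcosh y)]

/-- The inverse of `C : (-π², ∞) → (-1, ∞)`. -/
noncomputable def invC (y : ℝ) : ℝ := Function.invFunOn C (Ioi (-π ^ 2)) y

theorem invC_gt {y : ℝ} (hy : -1 < y) : -π ^ 2 < invC y :=
  Function.invFunOn_mem (exists_C_eq hy)

theorem C_invC {y : ℝ} (hy : -1 < y) : C (invC y) = y :=
  Function.invFunOn_eq (exists_C_eq hy)

theorem invC_C {x : ℝ} (hx : -π ^ 2 < x) : invC (C x) = x :=
  strictMonoOn_C.injOn (invC_gt (neg_one_lt_C hx)).le hx.le (C_invC (neg_one_lt_C hx))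

theorem continuousAt_invC {y : ℝ} (hy : -1 < y) : ContinuousAt invC y := by
  have hmono : StrictMonoOn invC (Ioi (-1)) := fun a ha b hb hab ↦ by
    rwa [← strictMonoOn_C.lt_iff_lt (invC_gt ha).le (invC_gt hb).le, C_invC ha, C_invC hb]
  refine hmono.continuousAt_of_image_mem_nhds (Ioi_mem_nhds hy) ?_
  filter_upwards [Ioi_mem_nhds (invC_gt hy)] with x hx
  exact ⟨C x, neg_one_lt_C hx, invC_C hx⟩

theorem hasDerivAt_invC {y : ℝ} (hy : -1 < y) : HasDerivAt invC (S (invC y) / 2)⁻¹ y := by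
  refine (hasDerivAt_C _).of_local_left_inverse (continuousAt_invC hy)
    (half_pos (S_pos (invC_gt hy))).ne' ?_
  filter_upwards [Ioi_mem_nhds hy] with z hz using C_invC hz

/-- If `h² - g² ≤ 1` and `h' = c g`, `g' = c h` with `0 ≤ c`, then `g / S (invC h)` has derivative
at most `c`. -/
theorem hasDerivAt_div_S_invC_le {g h : ℝ → ℝ} {c v : ℝ} (hc : 0 ≤ c)
    (hg : HasDerivAt g (c * h v) v) (hh : HasDerivAt h (c * g v) v)
    (hgh : h v ^ 2 - g v ^ 2 ≤ 1) (hv : -1 < h v) :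
    ∃ d ≤ c, HasDerivAt (fun w ↦ g w / S (invC (h w))) d v := by
  have hx := invC_gt hv
  have hS := S_pos hx
  refine ⟨_, ?_, hg.div ((hasDerivAt_S _).comp v ((hasDerivAt_invC hv).comp v hh)) hS.ne'⟩
  have hD := S'_nonneg hx
  have h1 := C_sq_sub_mul_S_sq (invC (h v))
  have h2 := two_mul_mul_S' (invC (h v))
  have hC := C_invC hv
  generalize invC (h v) = x at *
  rw [← hC] at hgh ⊢
  have key : C x * S x ^ 2 - 2 * g v ^ 2 * S' x ≤ S x ^ 3 := by
    have : x * S x ^ 2 * S' x ≤ g v ^ 2 * S' x := by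
      gcongr
      linarith
    linear_combination 2 * this - S x ^ 2 * h2
  rw [div_le_iff₀ (by positivity)]
  have e : c * C x * S x - g v * (S' x * ((S x / 2)⁻¹ * (c * g v))) =
      c * (C x * S x ^ 2 - 2 * g v ^ 2 * S' x) / S x := by
    field_simp
  rw [e, div_le_iff₀ hS]
  linear_combination c * key

theorem quadratic_pos_of_mem_Icc {A B p p₁ p₂ : ℝ} (hp₁ : 0 < p₁) (h₁ : p₁ ≤ p) (h₂ : p ≤ p₂)
    (hq₁ : 0 < A * p₁ ^ 2 + 2 * p₁ + B) (hq₂ : 0 < A * p₂ ^ 2 + 2 * p₂ + B) :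
    0 < A * p ^ 2 + 2 * p + B := by
  rcases le_total 0 A with hA | hA
  · have : A * p₁ ^ 2 ≤ A * p ^ 2 := by gcongr
    linarith
  · rcases h₁.eq_or_lt with rfl | h₁
    · exact hq₁
    have h : 0 < (p₂ - p₁) * (A * p ^ 2 + 2 * p + B) := by
      have e1 : 0 ≤ -A * ((p₂ - p₁) * (p - p₁) * (p₂ - p)) :=
        mul_nonneg (by linarith) (mul_nonneg (mul_nonneg (by linarith) (by linarith)) (by linarith))
      have e2 := mul_pos (sub_pos.mpr h₁) hq₂
      have e3 := mul_nonneg (sub_nonneg.mpr h₂) hq₁.le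
      linear_combination e1 + e2 + e3
    exact pos_of_mul_pos_right h (by linarith)

theorem neg_one_lt_half_exp_iff (A B t : ℝ) :
    -1 < (exp t * A + exp (-t) * B) / 2 ↔ 0 < A * exp t ^ 2 + 2 * exp t + B := by
  have he := exp_pos t
  have : A * exp t ^ 2 + 2 * exp t + B =
      2 * exp t * ((exp t * A + exp (-t) * B) / 2 + 1) := by
    rw [exp_neg]
    field_simp
    ring
  rw [this, mul_pos_iff_of_pos_left (by positivity)]
  constructor <;> intro h <;> linarith

/-- The equation `v S(x) = g(v)`, `C(x) = h(v)` has at most one solution with `x > -π²`. -/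
theorem eq_of_exp_mul_eq {c A B v₁ v₂ x₁ x₂ : ℝ} (hc : 0 ≤ c) (hc1 : c < 1) (hAB : A * B ≤ 1)
    (hx₁ : -π ^ 2 < x₁) (hx₂ : -π ^ 2 < x₂)
    (hA₁ : C x₁ + v₁ * S x₁ = exp (c * v₁) * A) (hB₁ : C x₁ - v₁ * S x₁ = exp (-(c * v₁)) * B)
    (hA₂ : C x₂ + v₂ * S x₂ = exp (c * v₂) * A) (hB₂ : C x₂ - v₂ * S x₂ = exp (-(c * v₂)) * B)
    (hlt : v₁ < v₂) : False := by
  let h : ℝ → ℝ := fun v ↦ (exp (c * v) * A + exp (-(c * v)) * B) / 2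
  let g : ℝ → ℝ := fun v ↦ (exp (c * v) * A - exp (-(c * v)) * B) / 2
  have hC₁ : h v₁ = C x₁ := by simp only [h]; linarith
  have hC₂ : h v₂ = C x₂ := by simp only [h]; linarith
  have hS₁ : g v₁ = v₁ * S x₁ := by simp only [g]; linarith
  have hS₂ : g v₂ = v₂ * S x₂ := by simp only [g]; linarith
  have hpos : ∀ v ∈ Icc v₁ v₂, -1 < h v := fun v hv ↦ by
    have h₁ : c * v₁ ≤ c * v := mul_le_mul_of_nonneg_left hv.1 hc
    have h₂ : c * v ≤ c * v₂ := mul_le_mul_of_nonneg_left hv.2 hc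
    refine (neg_one_lt_half_exp_iff A B _).mpr (quadratic_pos_of_mem_Icc (exp_pos (c * v₁))
      (exp_le_exp.mpr h₁) (exp_le_exp.mpr h₂)
      ((neg_one_lt_half_exp_iff A B _).mp ?_) ((neg_one_lt_half_exp_iff A B _).mp ?_))
    · exact (neg_one_lt_C hx₁).trans_eq hC₁.symm
    · exact (neg_one_lt_C hx₂).trans_eq hC₂.symm
  have hlin (v : ℝ) : HasDerivAt (fun w ↦ c * w) c v := by
    simpa using (hasDerivAt_id v).const_mul c
  have hh (v : ℝ) : HasDerivAt h (c * g v) v := by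
    convert! (((hlin v).exp.mul_const A).add ((hlin v).fun_neg.exp.mul_const B)).div_const 2 using 1
    simp only [g]
    ring
  have hg (v : ℝ) : HasDerivAt g (c * h v) v := by
    convert! (((hlin v).exp.mul_const A).sub ((hlin v).fun_neg.exp.mul_const B)).div_const 2 using 1
    simp only [h]
    ring
  have hgh (v : ℝ) : h v ^ 2 - g v ^ 2 ≤ 1 := by
    have : exp (c * v) * exp (-(c * v)) = 1 := by rw [← exp_add]; simp
    simp only [h, g]
    linear_combination hAB + A * B * this
  have hderiv : ∀ v ∈ Icc v₁ v₂,
      ∃ d > 0, HasDerivAt (fun w ↦ w - g w / S (invC (h w))) d v := fun v hv ↦ by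
    obtain ⟨d, hd, hd'⟩ := hasDerivAt_div_S_invC_le hc (hg v) (hh v) (hgh v) (hpos v hv)
    exact ⟨1 - d, by linarith, (hasDerivAt_id v).sub hd'⟩
  have hmono : StrictMonoOn (fun w ↦ w - g w / S (invC (h w))) (Icc v₁ v₂) := by
    refine strictMonoOn_of_deriv_pos (convex_Icc _ _) (fun v hv ↦ ?_) fun v hv ↦ ?_
    · obtain ⟨d, -, hd⟩ := hderiv v hv
      exact hd.continuousAt.continuousWithinAt
    · obtain ⟨d, hd0, hd⟩ := hderiv v (interior_subset hv)
      rwa [hd.deriv]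
  have := hmono (left_mem_Icc.mpr hlt.le) (right_mem_Icc.mpr hlt.le) hlt
  simp only [hC₁, hC₂, hS₁, hS₂, invC_C hx₁, invC_C hx₂] at this
  rw [mul_div_cancel_right₀ _ (S_pos hx₁).ne', mul_div_cancel_right₀ _ (S_pos hx₂).ne'] at this
  simp at this

end

/-- For `m ≤ -1` the reduced polar map `Φₘ` is injective on the slice
`Σₘ = {(u,a) : a ≥ 0, 4u²m² - 4a² > -π²}`. -/
theorem stmt17 (m : ℝ) (hm : m ≤ -1) :
    Set.InjOn (Phi m)
      {p : ℝ × ℝ | 0 ≤ p.2 ∧ 4 * p.1 ^ 2 * m ^ 2 - 4 * p.2 ^ 2 > -π ^ 2} := by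
  rintro ⟨u₁, a₁⟩ ⟨ha₁, hx₁⟩ ⟨u₂, a₂⟩ ⟨ha₂, hx₂⟩ heq
  have hm0 : m ≠ 0 := by linarith
  simp only [Phi, Prod.mk.injEq] at heq ha₁ ha₂ hx₁ hx₂
  obtain ⟨hA, hB⟩ := heq
  set x₁ := 4 * u₁ ^ 2 * m ^ 2 - 4 * a₁ ^ 2 with hx₁_def
  set x₂ := 4 * u₂ ^ 2 * m ^ 2 - 4 * a₂ ^ 2 with hx₂_def
  have hexp (t r : ℝ) : r = exp t * (exp (-t) * r) := by
    rw [← mul_assoc, ← exp_add]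
    simp
  have hexp' (t r : ℝ) : r = exp (-t) * (exp t * r) := by
    rw [← mul_assoc, ← exp_add]
    simp
  have hAB : (exp (-(2 * u₁ * (1 + m))) * (C x₁ + 2 * u₁ * m * S x₁)) *
      (exp (2 * u₁ * (1 + m)) * (C x₁ - 2 * u₁ * m * S x₁)) ≤ 1 := by
    have h1 : exp (-(2 * u₁ * (1 + m))) * exp (2 * u₁ * (1 + m)) = 1 := by
      rw [← exp_add]
      simp
    have h2 := C_sq_sub_mul_S_sq x₁
    have h3 : 0 ≤ 4 * (a₁ * S x₁) ^ 2 := by positivity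
    linear_combination (C x₁ ^ 2 - (2 * u₁ * m * S x₁) ^ 2) * h1 + h2 + h3 + S x₁ ^ 2 * hx₁_def
  have hc : 0 ≤ (1 + m) / m := div_nonneg_of_nonpos (by linarith) (by linarith)
  have hc1 : (1 + m) / m < 1 := by
    rw [div_lt_one_of_neg (by linarith)]
    linarith
  have hcv (u : ℝ) : (1 + m) / m * (2 * u * m) = 2 * u * (1 + m) := by
    field_simp
  have hA₁ := hexp (2 * u₁ * (1 + m)) (C x₁ + 2 * u₁ * m * S x₁)
  have hB₁ := hexp' (2 * u₁ * (1 + m)) (C x₁ - 2 * u₁ * m * S x₁)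
  have hA₂ := hexp (2 * u₂ * (1 + m)) (C x₂ + 2 * u₂ * m * S x₂)
  have hB₂ := hexp' (2 * u₂ * (1 + m)) (C x₂ - 2 * u₂ * m * S x₂)
  rw [← hA] at hA₂
  rw [← hB] at hB₂
  nth_rewrite 1 [← hcv] at hA₂ hB₂
  have hu : u₁ = u₂ := by
    have hv : 2 * u₁ * m = 2 * u₂ * m := by
      rcases lt_trichotomy (2 * u₁ * m) (2 * u₂ * m) with h | h | h
      · refine (eq_of_exp_mul_eq hc hc1 hAB hx₁ hx₂ ?_ ?_ hA₂ hB₂ h).elim <;> rwa [hcv]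
      · exact h
      · refine (eq_of_exp_mul_eq hc hc1 hAB hx₂ hx₁ hA₂ hB₂ ?_ ?_ h).elim <;> rwa [hcv]
    have := mul_right_cancel₀ hm0 hv
    linarith
  subst hu
  have hCeq : C x₁ = C x₂ := by
    have h1 := mul_left_cancel₀ (exp_pos _).ne' hA
    have h2 := mul_left_cancel₀ (exp_pos _).ne' hB
    linarith
  have hx : x₁ = x₂ := strictMonoOn_C.injOn hx₁.le hx₂.le hCeq
  have ha : a₁ ^ 2 = a₂ ^ 2 := by linarith
  rw [(pow_left_inj₀ ha₁ ha₂ two_ne_zero).mp ha]
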